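/- Let X be a compact metric space, let A₁ and A₂ be closed subalgebras of C(X) containing the constants, and let {x₁, x₂, ...} be an infinite bolt with respect to A₁ and A₂. For each k let r_k denote the bolt functional associated with the finite bolt l_k = {x₁,...,x_k}. Then the sequence (r_k) has a weak-* convergent subsequence, and every weak-* limit r* of a subsequence of (r_k) satisfies ‖r*‖ ≤ 1 and r*(F) = 0 for every F ∈ A₁ + A₂. -/

import Mathlib

open Filter Topology

/-- Two points `a, b` of `X` are linked via the algebra `A ⊆ C(X)` if every
element of `A` takes equal values at `a` and `b`. -/
def AlgLink {X : Type*} [TopologicalSpace X] (A : Subalgebra ℝ C(X, ℝ)) (a b : X) : Prop :=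
  ∀ g : C(X, ℝ), g ∈ A → g a = g b

/-- `x 0, x 1, ..., x (n-1)` is a finite (lightning) bolt with respect to the
algebras `A₁, A₂`: consecutive points are distinct and the consecutive links
alternate between `A₁`-links and `A₂`-links (in one of the two possible orders). -/
def IsFiniteBolt {X : Type*} [TopologicalSpace X] (A₁ A₂ : Subalgebra ℝ C(X, ℝ)) {n : ℕ}
    (x : Fin n → X) : Prop :=
  (∀ (i : ℕ) (h : i + 1 < n), x ⟨i, Nat.lt_of_succ_lt h⟩ ≠ x ⟨i + 1, h⟩) ∧
  ((∀ (i : ℕ) (h : i + 1 < n),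
      if Even i then AlgLink A₁ (x ⟨i, Nat.lt_of_succ_lt h⟩) (x ⟨i + 1, h⟩)
      else AlgLink A₂ (x ⟨i, Nat.lt_of_succ_lt h⟩) (x ⟨i + 1, h⟩)) ∨
   (∀ (i : ℕ) (h : i + 1 < n),
      if Even i then AlgLink A₂ (x ⟨i, Nat.lt_of_succ_lt h⟩) (x ⟨i + 1, h⟩)
      else AlgLink A₁ (x ⟨i, Nat.lt_of_succ_lt h⟩) (x ⟨i + 1, h⟩)))

/-- The cyclically next index in `Fin m`. -/
def nextIdx {m : ℕ} (i : Fin m) : Fin m := ⟨((i : ℕ) + 1) % m, Nat.mod_lt _ i.pos⟩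

/-- `x 0, ..., x (m-1)` is a closed bolt with respect to `A₁, A₂`: the number of
points is even and positive, cyclically consecutive points are distinct, and the
cyclic links alternate between `A₁`-links and `A₂`-links. -/
def IsClosedBolt {X : Type*} [TopologicalSpace X] (A₁ A₂ : Subalgebra ℝ C(X, ℝ)) {m : ℕ}
    (x : Fin m → X) : Prop :=
  0 < m ∧ Even m ∧
  (∀ i : Fin m, x i ≠ x (nextIdx i)) ∧
  ((∀ i : Fin m, if Even (i : ℕ) then AlgLink A₁ (x i) (x (nextIdx i))
      else AlgLink A₂ (x i) (x (nextIdx i))) ∨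
   (∀ i : Fin m, if Even (i : ℕ) then AlgLink A₂ (x i) (x (nextIdx i))
      else AlgLink A₁ (x i) (x (nextIdx i))))

/-- `x 0, x 1, x 2, ...` is an infinite bolt with respect to `A₁, A₂`. -/
def IsInfiniteBolt {X : Type*} [TopologicalSpace X] (A₁ A₂ : Subalgebra ℝ C(X, ℝ))
    (x : ℕ → X) : Prop :=
  (∀ i : ℕ, x i ≠ x (i + 1)) ∧
  ((∀ i : ℕ, if Even i then AlgLink A₁ (x i) (x (i + 1)) else AlgLink A₂ (x i) (x (i + 1))) ∨
   (∀ i : ℕ, if Even i then AlgLink A₂ (x i) (x (i + 1)) else AlgLink A₁ (x i) (x (i + 1))))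

/-- The bolt functional `r_l(F) = (1/n) ∑_{i=1}^n (-1)^{i+1} F(xᵢ)` associated with
the finite bolt `l = {x 0, ..., x (n-1)}` (here indexed from `0`). -/
noncomputable def boltFun {X : Type*} [TopologicalSpace X] {n : ℕ} (x : Fin n → X)
    (F : C(X, ℝ)) : ℝ :=
  (n : ℝ)⁻¹ * ∑ i : Fin n, (-1 : ℝ) ^ (i : ℕ) * F (x i)

/-- The set `A₁ + A₂ = {u₁ + u₂ : u₁ ∈ A₁, u₂ ∈ A₂}`. -/
def algSum {X : Type*} [TopologicalSpace X] (A₁ A₂ : Subalgebra ℝ C(X, ℝ)) : Set C(X, ℝ) :=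
  {u | ∃ u₁ ∈ A₁, ∃ u₂ ∈ A₂, u = u₁ + u₂}

/-- The approximation error `E(f) = inf_{u ∈ A₁+A₂} ‖f - u‖`. -/
noncomputable def approxError {X : Type*} [TopologicalSpace X] [CompactSpace X]
    (A₁ A₂ : Subalgebra ℝ C(X, ℝ)) (f : C(X, ℝ)) : ℝ :=
  ⨅ u : algSum A₁ A₂, ‖f - (u : C(X, ℝ))‖

/-- A finite bolt `x 0, ..., x (n-1)` is extremal for `h ∈ C(X)` if
`h (x i) = (-1)^i ‖h‖` for all `i`, or `h (x i) = (-1)^{i+1} ‖h‖` for all `i`. -/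
def ExtremalFin {X : Type*} [TopologicalSpace X] [CompactSpace X] {n : ℕ}
    (h : C(X, ℝ)) (x : Fin n → X) : Prop :=
  (∀ i : Fin n, h (x i) = (-1 : ℝ) ^ (i : ℕ) * ‖h‖) ∨
  (∀ i : Fin n, h (x i) = (-1 : ℝ) ^ ((i : ℕ) + 1) * ‖h‖)

/-- An infinite bolt `x 0, x 1, ...` is extremal for `h ∈ C(X)` if
`h (x i) = (-1)^i ‖h‖` for all `i`, or `h (x i) = (-1)^{i+1} ‖h‖` for all `i`. -/
def ExtremalSeq {X : Type*} [TopologicalSpace X] [CompactSpace X]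
    (h : C(X, ℝ)) (x : ℕ → X) : Prop :=
  (∀ i : ℕ, h (x i) = (-1 : ℝ) ^ i * ‖h‖) ∨
  (∀ i : ℕ, h (x i) = (-1 : ℝ) ^ (i + 1) * ‖h‖)

/-- If `y (2m) = y (2m+1)` for all `m`, the alternating partial sums of `y` are bounded by any
bound for `y`. -/
theorem abs_sum_alternating_le_of_even {y : ℕ → ℝ} {C : ℝ} (hC : ∀ i, |y i| ≤ C)
    (h : ∀ i, Even i → y i = y (i + 1)) (n : ℕ) :
    |∑ i ∈ Finset.range n, (-1 : ℝ) ^ i * y i| ≤ C := by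
  have heven : ∀ m : ℕ, ∑ i ∈ Finset.range (2 * m), (-1 : ℝ) ^ i * y i = 0 := by
    intro m
    induction m with
    | zero => simp
    | succ m ih =>
      rw [mul_add_one, Finset.sum_range_succ, Finset.sum_range_succ, ih,
        ← h (2 * m) (even_two_mul m)]
      ring
  rcases Nat.even_or_odd' n with ⟨m, rfl | rfl⟩
  · simpa [heven] using (abs_nonneg _).trans (hC 0)
  · simpa [Finset.sum_range_succ, heven, abs_mul] using hC (2 * m)

/-- If `y (2m+1) = y (2m+2)` for all `m`, the alternating partial sums of `y` are bounded by twice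
any bound for `y`. -/
theorem abs_sum_alternating_le_of_odd {y : ℕ → ℝ} {C : ℝ} (hC : ∀ i, |y i| ≤ C)
    (h : ∀ i, ¬ Even i → y i = y (i + 1)) (n : ℕ) :
    |∑ i ∈ Finset.range n, (-1 : ℝ) ^ i * y i| ≤ 2 * C := by
  have hC0 : 0 ≤ C := (abs_nonneg _).trans (hC 0)
  cases n with
  | zero => simpa using hC0
  | succ n =>
    have hshift := abs_sum_alternating_le_of_even (y := fun i => y (i + 1))
      (fun i => hC (i + 1)) (fun i hi => h (i + 1) (by simpa [Nat.even_add_one] using hi)) n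
    have hsum : ∑ i ∈ Finset.range (n + 1), (-1 : ℝ) ^ i * y i =
        y 0 - ∑ i ∈ Finset.range n, (-1 : ℝ) ^ i * y (i + 1) := by
      rw [Finset.sum_range_succ', sub_eq_add_neg, ← Finset.sum_neg_distrib, add_comm]
      simp [pow_succ]
    rw [hsum, two_mul]
    exact (abs_sub _ _).trans (add_le_add (hC 0) hshift)

section BoltFunctional

variable {X : Type*} [TopologicalSpace X]

theorem boltFun_add {n : ℕ} (x : Fin n → X) (F G : C(X, ℝ)) :
    boltFun x (F + G) = boltFun x F + boltFun x G := by
  simp [boltFun, mul_add, Finset.sum_add_distrib]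

theorem boltFun_smul {n : ℕ} (x : Fin n → X) (c : ℝ) (F : C(X, ℝ)) :
    boltFun x (c • F) = c * boltFun x F := by
  simp only [boltFun, ContinuousMap.smul_apply, smul_eq_mul, Finset.mul_sum]
  exact Finset.sum_congr rfl fun i _ => by ring

theorem abs_boltFun_le [CompactSpace X] {n : ℕ} (x : Fin n → X) (F : C(X, ℝ)) :
    |boltFun x F| ≤ ‖F‖ := by
  rcases Nat.eq_zero_or_pos n with rfl | hn
  · simp [boltFun]
  have hn' : (0 : ℝ) < n := Nat.cast_pos.2 hn
  have hsum : |∑ i : Fin n, (-1 : ℝ) ^ (i : ℕ) * F (x i)| ≤ n * ‖F‖ := by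
    refine (Finset.abs_sum_le_sum_abs _ _).trans ?_
    refine (Finset.sum_le_card_nsmul _ _ ‖F‖ fun i _ => ?_).trans (by simp)
    simpa [abs_mul] using F.norm_coe_le_norm (x i)
  rw [boltFun, abs_mul, abs_of_pos (inv_pos.2 hn')]
  exact (inv_mul_le_iff₀ hn').2 hsum

/-- The bolt functional as a continuous linear functional on `C(X)`. -/
noncomputable def boltFunCLM [CompactSpace X] {n : ℕ} (x : Fin n → X) : C(X, ℝ) →L[ℝ] ℝ :=
  LinearMap.mkContinuous
    { toFun := boltFun x
      map_add' := boltFun_add x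
      map_smul' := boltFun_smul x } 1 fun F => by
    simpa using abs_boltFun_le x F

theorem norm_boltFunCLM_le [CompactSpace X] {n : ℕ} (x : Fin n → X) : ‖boltFunCLM x‖ ≤ 1 :=
  LinearMap.mkContinuous_norm_le _ zero_le_one _

/-- Along an infinite sequence linked by `g` at every other step, the bolt functionals of the
initial segments tend to `0` at `g`. -/
theorem tendsto_boltFun_zero [CompactSpace X] (x : ℕ → X) (g : C(X, ℝ))
    (h : (∀ i, Even i → g (x i) = g (x (i + 1))) ∨ ∀ i, ¬ Even i → g (x i) = g (x (i + 1))) :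
    Tendsto (fun n : ℕ => boltFun (fun i : Fin n => x i) g) atTop (𝓝 0) := by
  have hC : ∀ i, |g (x i)| ≤ ‖g‖ := fun i => g.norm_coe_le_norm (x i)
  have hbound : ∀ n : ℕ, |∑ i ∈ Finset.range n, (-1 : ℝ) ^ i * g (x i)| ≤ 2 * ‖g‖ := by
    rcases h with h | h
    · exact fun n => (abs_sum_alternating_le_of_even hC h n).trans
        (by linarith [norm_nonneg g])
    · exact abs_sum_alternating_le_of_odd hC h
  have hlim : Tendsto (fun n : ℕ => (n : ℝ)⁻¹ * (2 * ‖g‖)) atTop (𝓝 0) := by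
    simpa using (tendsto_inv_atTop_nhds_zero_nat (𝕜 := ℝ)).mul_const (2 * ‖g‖)
  refine squeeze_zero_norm (fun n => ?_) hlim
  rw [boltFun, Fin.sum_univ_eq_sum_range (fun i => (-1 : ℝ) ^ i * g (x i)), norm_mul, norm_inv,
    Real.norm_natCast]
  exact mul_le_mul_of_nonneg_left (hbound n) (by positivity)

theorem IsInfiniteBolt.tendsto_boltFun_zero [CompactSpace X] {A₁ A₂ : Subalgebra ℝ C(X, ℝ)}
    {x : ℕ → X} (hx : IsInfiniteBolt A₁ A₂ x) {F : C(X, ℝ)} (hF : F ∈ algSum A₁ A₂) :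
    Tendsto (fun n : ℕ => boltFun (fun i : Fin n => x i) F) atTop (𝓝 0) := by
  obtain ⟨u, hu, v, hv, rfl⟩ := hF
  have hsplit : Tendsto (fun n : ℕ => boltFun (fun i : Fin n => x i) u) atTop (𝓝 0) ∧
      Tendsto (fun n : ℕ => boltFun (fun i : Fin n => x i) v) atTop (𝓝 0) := by
    rcases hx.2 with h | h
    · exact ⟨_root_.tendsto_boltFun_zero x u
          (.inl fun i hi => by have := h i; rw [if_pos hi] at this; exact this u hu),
        _root_.tendsto_boltFun_zero x v
          (.inr fun i hi => by have := h i; rw [if_neg hi] at this; exact this v hv)⟩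
    · exact ⟨_root_.tendsto_boltFun_zero x u
          (.inr fun i hi => by have := h i; rw [if_neg hi] at this; exact this u hu),
        _root_.tendsto_boltFun_zero x v
          (.inl fun i hi => by have := h i; rw [if_pos hi] at this; exact this v hv)⟩
  simpa [boltFun_add] using hsplit.1.add hsplit.2

end BoltFunctional

theorem boltFunctionals_weakStar_subsequence {X : Type*} [MetricSpace X] [CompactSpace X]
    (A₁ A₂ : Subalgebra ℝ C(X, ℝ))
    (hA₁ : IsClosed (A₁ : Set C(X, ℝ))) (hA₂ : IsClosed (A₂ : Set C(X, ℝ)))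
    (x : ℕ → X) (hx : IsInfiniteBolt A₁ A₂ x) :
    (∃ φ : ℕ → ℕ, StrictMono φ ∧ ∃ r : C(X, ℝ) →L[ℝ] ℝ, ∀ F : C(X, ℝ),
        Tendsto (fun k : ℕ => boltFun (fun i : Fin (φ k) => x (i : ℕ)) F) atTop (𝓝 (r F))) ∧
    (∀ (r : C(X, ℝ) →L[ℝ] ℝ) (φ : ℕ → ℕ), StrictMono φ →
        (∀ F : C(X, ℝ),
          Tendsto (fun k : ℕ => boltFun (fun i : Fin (φ k) => x (i : ℕ)) F) atTop (𝓝 (r F))) →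
        ‖r‖ ≤ 1 ∧ ∀ F ∈ algSum A₁ A₂, r F = 0) := by
  refine ⟨?_, fun r φ hφ hr => ⟨?_, fun F hF => ?_⟩⟩
  · obtain ⟨r, -, φ, hφ, hlim⟩ := WeakDual.isSeqCompact_closedBall ℝ C(X, ℝ) 0 1
      (x := fun n : ℕ => StrongDual.toWeakDual (boltFunCLM fun i : Fin n => x i))
      (fun n => by
        simpa using norm_boltFunCLM_le fun i : Fin n => x i)
    exact ⟨φ, hφ, WeakDual.toStrongDual r, fun F =>
      ((WeakDual.eval_continuous F).tendsto r).comp hlim⟩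
  · refine r.opNorm_le_bound zero_le_one fun F => ?_
    rw [one_mul]
    exact le_of_tendsto (hr F).norm (Eventually.of_forall fun k => abs_boltFun_le _ F)
  · exact tendsto_nhds_unique (hr F) ((hx.tendsto_boltFun_zero hF).comp hφ.tendsto_atTop)
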